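/- Weighted L² coercivity of 𝓛_Γ: for every α ∈ (0,1] and every admissible f, (𝓛_Γ(f)·w, f·w)_{L²} ≥ (1/4)‖f·w‖²_{L²}. -/

import Mathlib

open Real MeasureTheory Set Filter

noncomputable section

/-- The angular kernel `K(θ) = 3 sin θ cos² θ`. -/
def Kker (θ : ℝ) : ℝ := 3 * Real.sin θ * Real.cos θ ^ 2

/-- `L₁₂(f)(z) = ∫_z^∞ ∫_0^{π/2} f(r,θ) K(θ)/r dθ dr`. -/
def L12 (f : ℝ → ℝ → ℝ) (z : ℝ) : ℝ :=
  ∫ r in Ioi z, ∫ θ in Icc 0 (π / 2), f r θ * Kker θ / r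

/-- The radial weight `w(z) = (1+z)²/z²`. -/
def wgt (z : ℝ) : ℝ := (1 + z) ^ 2 / z ^ 2

/-- `D_θ f = sin(2θ) ∂_θ f`. -/
def Dth (f : ℝ → ℝ → ℝ) (z θ : ℝ) : ℝ := Real.sin (2 * θ) * deriv (fun t => f z t) θ

/-- `D_z f = z ∂_z f`. -/
def Dzr (f : ℝ → ℝ → ℝ) (z θ : ℝ) : ℝ := z * deriv (fun s => f s θ) z

/-- `Γ(θ) = (sin θ cos² θ)^{α/3}`. -/
def Gam (α θ : ℝ) : ℝ := (Real.sin θ * Real.cos θ ^ 2) ^ (α / 3)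

/-- `c = ∫_0^{π/2} Γ(θ) K(θ) dθ`. -/
def cGam (α : ℝ) : ℝ := ∫ θ in Icc 0 (π / 2), Gam α θ * Kker θ

/-- `𝓛(f) = f + z ∂_z f - 2 f/(1+z)`. -/
def Lop (f : ℝ → ℝ → ℝ) (z θ : ℝ) : ℝ :=
  f z θ + z * deriv (fun s => f s θ) z - 2 * f z θ / (1 + z)

/-- `𝓛_Γ(f) = 𝓛(f) - (2zΓ(θ)/(c(1+z)²)) L₁₂(f)`. -/
def LGam (α : ℝ) (f : ℝ → ℝ → ℝ) (z θ : ℝ) : ℝ :=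
  Lop f z θ - 2 * z * Gam α θ / (cGam α * (1 + z) ^ 2) * L12 f z

/-- `ℙ(f)(z,θ) = f(z,θ) - (Γ(θ)/c)(2z²/(1+z)³) L₁₂(f)(0)`. -/
def Pproj (α : ℝ) (f : ℝ → ℝ → ℝ) (z θ : ℝ) : ℝ :=
  f z θ - Gam α θ / cGam α * (2 * z ^ 2 / (1 + z) ^ 3) * L12 f 0

/-- `𝓛_Γ^T(f) = 𝓛_Γ(f) - ℙ((3/(1+z)) D_θ f)`. -/
def LGamT (α : ℝ) (f : ℝ → ℝ → ℝ) (z θ : ℝ) : ℝ :=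
  LGam α f z θ - Pproj α (fun z2 θ2 => 3 / (1 + z2) * Dth f z2 θ2) z θ

/-- The `L²` inner product on `[0,∞) × [0,π/2]` with respect to `dz dθ`. -/
def ip (A B : ℝ → ℝ → ℝ) : ℝ :=
  ∫ z in Ioi (0 : ℝ), ∫ θ in Icc 0 (π / 2), A z θ * B z θ

/-- `f` is admissible: smooth on `[0,∞) × [0,π/2]` and vanishing for `z` outside a
compact subset of `(0,∞)`. -/
def Admissible (f : ℝ → ℝ → ℝ) : Prop :=
  ContDiff ℝ (⊤ : ℕ∞) (Function.uncurry f) ∧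
  ∃ a b : ℝ, 0 < a ∧ ∀ z θ : ℝ, z ∉ Icc a b → f z θ = 0


lemma integrableOn_angle {u : ℝ → ℝ} (hu : Continuous u) :
    IntegrableOn u (Icc 0 (π / 2)) :=
  hu.continuousOn.integrableOn_compact isCompact_Icc

/-- Chebyshev's integral inequality for similarly ordered functions, with a weight. -/
lemma weighted_chebyshev {S : Set ℝ} {ρ u v : ℝ → ℝ} (hS : MeasurableSet S)
    (hρ : ∀ x ∈ S, 0 ≤ ρ x)
    (huv : ∀ x ∈ S, ∀ y ∈ S, 0 ≤ (u x - u y) * (v x - v y))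
    (i0 : IntegrableOn ρ S) (iu : IntegrableOn (fun x => ρ x * u x) S)
    (iv : IntegrableOn (fun x => ρ x * v x) S)
    (iuv : IntegrableOn (fun x => ρ x * (u x * v x)) S) :
    (∫ x in S, ρ x * u x) * (∫ x in S, ρ x * v x) ≤
      (∫ x in S, ρ x) * ∫ x in S, ρ x * (u x * v x) := by
  have inner : ∀ y ∈ S, 0 ≤ (∫ x in S, ρ x * (u x * v x)) - u y * (∫ x in S, ρ x * v x)
      - v y * (∫ x in S, ρ x * u x) + u y * v y * ∫ x in S, ρ x := by
    intro y hy
    have h : 0 ≤ ∫ x in S, ρ x * ((u x - u y) * (v x - v y)) :=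
      setIntegral_nonneg hS fun x hx => mul_nonneg (hρ x hx) (huv x hx y hy)
    have e : (fun x => ρ x * ((u x - u y) * (v x - v y))) = fun x =>
        ρ x * (u x * v x) - u y * (ρ x * v x) - v y * (ρ x * u x) + u y * v y * ρ x := by
      funext x; ring
    rw [e, integral_add, integral_sub, integral_sub] at h
    · simpa only [integral_const_mul] using h
    · exact iuv
    · exact iv.const_mul _
    · exact iuv.sub (iv.const_mul _)
    · exact iu.const_mul _
    · exact (iuv.sub (iv.const_mul _)).sub (iu.const_mul _)
    · exact i0.const_mul _
  set A := ∫ x in S, ρ x * (u x * v x)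
  set V := ∫ x in S, ρ x * v x
  set U := ∫ x in S, ρ x * u x
  set M := ∫ x in S, ρ x
  have h : 0 ≤ ∫ y in S, ρ y * (A - u y * V - v y * U + u y * v y * M) :=
    setIntegral_nonneg hS fun y hy => mul_nonneg (hρ y hy) (inner y hy)
  have e : (fun y => ρ y * (A - u y * V - v y * U + u y * v y * M)) = fun y =>
      A * ρ y - V * (ρ y * u y) - U * (ρ y * v y) + M * (ρ y * (u y * v y)) := by
    funext y; ring
  rw [e, integral_add, integral_sub, integral_sub] at h
  · simp only [integral_const_mul] at h
    change 0 ≤ A * M - V * U - U * V + M * A at h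
    linarith
  · exact i0.const_mul _
  · exact iu.const_mul _
  · exact (i0.const_mul _).sub (iu.const_mul _)
  · exact iv.const_mul _
  · exact ((i0.const_mul _).sub (iu.const_mul _)).sub (iv.const_mul _)
  · exact iuv.const_mul _

lemma rpow_sub_mul_rpow_sub_nonneg {x y p q : ℝ} (hx : 0 ≤ x) (hy : 0 ≤ y) (hp : 0 ≤ p)
    (hq : 0 ≤ q) : 0 ≤ (x ^ p - y ^ p) * (x ^ q - y ^ q) := by
  rcases le_total x y with h | h
  · exact mul_nonneg_of_nonpos_of_nonpos
      (sub_nonpos.2 (rpow_le_rpow hx h hp)) (sub_nonpos.2 (rpow_le_rpow hx h hq))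
  · exact mul_nonneg (sub_nonneg.2 (rpow_le_rpow hy h hp)) (sub_nonneg.2 (rpow_le_rpow hy h hq))

lemma sin_mul_cos_sq_nonneg {θ : ℝ} (h : θ ∈ Icc 0 (π / 2)) :
    0 ≤ Real.sin θ * Real.cos θ ^ 2 :=
  mul_nonneg (sin_nonneg_of_nonneg_of_le_pi h.1 (by linarith [h.2, pi_pos])) (sq_nonneg _)

lemma integral_sin_mul_cos_sq_angle :
    ∫ θ in Icc 0 (π / 2), Real.sin θ * Real.cos θ ^ 2 = 1 / 3 := by
  rw [integral_Icc_eq_integral_Ioc, ← intervalIntegral.integral_of_le (by positivity),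
    intervalIntegral.integral_eq_sub_of_hasDerivAt (f := fun θ => -Real.cos θ ^ 3 / 3)]
  · simp
    norm_num
  · intro θ _
    refine (((hasDerivAt_cos θ).pow 3).neg.div_const 3).congr_deriv ?_
    simp only [Nat.cast_ofNat]
    ring
  · exact (by fun_prop : Continuous fun θ => Real.sin θ * Real.cos θ ^ 2).intervalIntegrable _ _

lemma integral_sin_mul_cos_sq_sq_angle :
    ∫ θ in Icc 0 (π / 2), (Real.sin θ * Real.cos θ ^ 2) ^ 2 = π / 32 := by
  rw [integral_Icc_eq_integral_Ioc, ← intervalIntegral.integral_of_le (by positivity),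
    intervalIntegral.integral_eq_sub_of_hasDerivAt
      (f := fun θ => -(Real.sin θ * Real.cos θ ^ 5) / 6 + Real.sin θ * Real.cos θ ^ 3 / 24
        + (θ + Real.sin θ * Real.cos θ) / 16)]
  · simp
    ring
  · intro θ _
    have h1 := (((hasDerivAt_sin θ).mul ((hasDerivAt_cos θ).pow 5)).neg.div_const 6)
    have h2 := (((hasDerivAt_sin θ).mul ((hasDerivAt_cos θ).pow 3)).div_const 24)
    have h3 := (((hasDerivAt_id θ).add ((hasDerivAt_sin θ).mul (hasDerivAt_cos θ))).div_const 16)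
    refine ((h1.add h2).add h3).congr_deriv ?_
    have hs : Real.sin θ ^ 2 = 1 - Real.cos θ ^ 2 := sin_sq θ
    simp only [Pi.pow_apply]
    push_cast
    linear_combination -(Real.cos θ ^ 4 / 6 + Real.cos θ ^ 2 / 8 + 1 / 16) * hs
  · exact (by fun_prop : Continuous fun θ =>
      (Real.sin θ * Real.cos θ ^ 2) ^ 2).intervalIntegrable _ _

lemma continuous_Kker : Continuous Kker := by unfold Kker; fun_prop

lemma continuous_Gam {α : ℝ} (hα : 0 ≤ α) : Continuous (Gam α) := by
  unfold Gam
  exact Continuous.rpow_const (by fun_prop) fun _ => Or.inr (by positivity)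

lemma integral_Kker_sq : ∫ θ in Icc 0 (π / 2), Kker θ * Kker θ = 9 * (π / 32) := by
  rw [← integral_sin_mul_cos_sq_sq_angle, ← integral_const_mul]
  congr 1
  funext θ
  unfold Kker
  ring

lemma cGam_pos {α : ℝ} (hα : α ∈ Ioc (0 : ℝ) 1) : 0 < cGam α := by
  have h : ∫ θ in Icc 0 (π / 2), 3 * (Real.sin θ * Real.cos θ ^ 2) ^ 2 ≤ cGam α := by
    refine setIntegral_mono_on (integrableOn_angle (by fun_prop))
      (integrableOn_angle ((continuous_Gam hα.1.le).mul continuous_Kker)) measurableSet_Icc ?_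
    intro θ hθ
    have s0 := sin_mul_cos_sq_nonneg hθ
    have s1 : Real.sin θ * Real.cos θ ^ 2 ≤ 1 :=
      mul_le_one₀ (sin_le_one θ) (sq_nonneg _) (cos_sq_le_one θ)
    have h1 : Real.sin θ * Real.cos θ ^ 2 ≤ Gam α θ := by
      unfold Gam
      exact self_le_rpow_of_le_one s0 s1 (by linarith [hα.2])
    have h2 := mul_le_mul_of_nonneg_right h1 s0
    have h3 : Gam α θ * Kker θ = 3 * (Gam α θ * (Real.sin θ * Real.cos θ ^ 2)) := by
      unfold Kker; ring
    rw [h3, sq]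
    linarith
  rw [integral_const_mul, integral_sin_mul_cos_sq_sq_angle] at h
  have := pi_pos
  linarith

lemma integral_Gam_sq_mul_integral_Kker_sq_le {α : ℝ} (hα : α ∈ Ioc (0 : ℝ) 1) :
    (∫ θ in Icc 0 (π / 2), Gam α θ * Gam α θ) * (∫ θ in Icc 0 (π / 2), Kker θ * Kker θ) ≤
      3 / 2 * cGam α ^ 2 := by
  set s : ℝ → ℝ := fun θ => Real.sin θ * Real.cos θ ^ 2 with hs
  have hsc : Continuous s := by fun_prop
  have hs0 : ∀ θ ∈ Icc 0 (π / 2), 0 ≤ s θ := fun θ hθ => sin_mul_cos_sq_nonneg hθ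
  have hG := continuous_Gam hα.1.le
  have hV : Continuous fun θ => s θ ^ (1 - α / 3) :=
    hsc.rpow_const fun _ => Or.inr (by linarith [hα.2])
  have hG0 : ∀ θ ∈ Icc 0 (π / 2), 0 ≤ Gam α θ := fun θ hθ => rpow_nonneg (hs0 θ hθ) _
  have hGV : ∀ θ ∈ Icc 0 (π / 2), Gam α θ * s θ ^ (1 - α / 3) = s θ := by
    intro θ hθ
    change s θ ^ (α / 3) * s θ ^ (1 - α / 3) = s θ
    rw [← rpow_add' (hs0 θ hθ) (by norm_num)]
    simp
  have hS : ∫ θ in Icc 0 (π / 2), s θ = 1 / 3 := integral_sin_mul_cos_sq_angle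
  have hc : cGam α = 3 * ∫ θ in Icc 0 (π / 2), Gam α θ * s θ := by
    unfold cGam
    rw [← integral_const_mul]
    congr 1
    funext θ
    simp only [hs, Kker]
    ring
  have h1 := weighted_chebyshev (ρ := Gam α) (u := Gam α) (v := fun θ => s θ ^ (1 - α / 3))
    measurableSet_Icc hG0
    (fun x hx y hy => rpow_sub_mul_rpow_sub_nonneg (hs0 x hx) (hs0 y hy)
      (by linarith [hα.1]) (by linarith [hα.2]))
    (integrableOn_angle hG) (integrableOn_angle (hG.mul hG)) (integrableOn_angle (hG.mul hV))
    (integrableOn_angle (hG.mul (hG.mul hV)))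
  have h2 := weighted_chebyshev (ρ := fun _ => 1) (u := Gam α) (v := s)
    measurableSet_Icc (fun _ _ => zero_le_one)
    (fun x hx y hy => by
      simpa [Gam] using rpow_sub_mul_rpow_sub_nonneg (p := α / 3) (q := 1) (hs0 x hx) (hs0 y hy)
        (by linarith [hα.1]) zero_le_one)
    (integrableOn_angle continuous_const) (integrableOn_angle (continuous_const.mul hG))
    (integrableOn_angle (continuous_const.mul hsc))
    (integrableOn_angle (continuous_const.mul (hG.mul hsc)))
  rw [setIntegral_congr_fun (f := fun θ => Gam α θ * s θ ^ (1 - α / 3)) measurableSet_Icc hGV,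
    setIntegral_congr_fun (f := fun θ => Gam α θ * (Gam α θ * s θ ^ (1 - α / 3)))
      (g := fun θ => Gam α θ * s θ) measurableSet_Icc (fun θ hθ => by simp only [hGV θ hθ]), hS] at h1
  have hvol : ∫ _ in Icc 0 (π / 2), (1 : ℝ) = π / 2 := by
    simp [div_nonneg pi_nonneg zero_le_two]
  simp only [one_mul] at h2
  rw [hS, hvol] at h2
  rw [integral_Kker_sq]
  have hcp := cGam_pos hα
  rw [hc] at hcp ⊢
  set C := ∫ θ in Icc 0 (π / 2), Gam α θ * s θ
  set G := ∫ θ in Icc 0 (π / 2), Gam α θ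
  set Q := ∫ θ in Icc 0 (π / 2), Gam α θ * Gam α θ
  have hC : 0 < C := by linarith
  have h3 : Q ≤ 9 * (π / 2 * C) * C := by nlinarith
  have hpi : π ^ 2 ≤ 32 / 3 := by nlinarith [pi_lt_d2, pi_pos]
  calc Q * (9 * (π / 32)) ≤ 9 * (π / 2 * C) * C * (9 * (π / 32)) :=
        mul_le_mul_of_nonneg_right h3 (by positivity)
    _ = 81 / 64 * C ^ 2 * π ^ 2 := by ring
    _ ≤ 81 / 64 * C ^ 2 * (32 / 3) := mul_le_mul_of_nonneg_left hpi (by positivity)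
    _ = 3 / 2 * (3 * C) ^ 2 := by ring

lemma gram_form_nonneg {u v t : ℝ → ℝ} (hu : Continuous u) (hv : Continuous v)
    (ht : Continuous t) (p q r : ℝ) :
    0 ≤ p ^ 2 * (∫ θ in Icc 0 (π / 2), u θ * u θ) + q ^ 2 * (∫ θ in Icc 0 (π / 2), v θ * v θ)
      + r ^ 2 * (∫ θ in Icc 0 (π / 2), t θ * t θ)
      + 2 * p * q * (∫ θ in Icc 0 (π / 2), u θ * v θ)
      + 2 * p * r * (∫ θ in Icc 0 (π / 2), u θ * t θ)
      + 2 * q * r * ∫ θ in Icc 0 (π / 2), v θ * t θ := by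
  have h : 0 ≤ ∫ θ in Icc 0 (π / 2), (p * u θ + q * v θ + r * t θ) ^ 2 :=
    setIntegral_nonneg measurableSet_Icc fun _ _ => sq_nonneg _
  have e : (fun θ => (p * u θ + q * v θ + r * t θ) ^ 2) = fun θ =>
      p ^ 2 * (u θ * u θ) + q ^ 2 * (v θ * v θ) + r ^ 2 * (t θ * t θ)
        + 2 * p * q * (u θ * v θ) + 2 * p * r * (u θ * t θ) + 2 * q * r * (v θ * t θ) := by
    funext θ; ring
  rw [e] at h
  rw [integral_add, integral_add, integral_add, integral_add, integral_add] at h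
  · simpa only [integral_const_mul] using h
  all_goals exact integrableOn_angle (by fun_prop)

lemma hasDerivAt_fst {f : ℝ → ℝ → ℝ} (hf : ContDiff ℝ (⊤ : ℕ∞) (Function.uncurry f))
    (z θ : ℝ) :
    HasDerivAt (fun s => f s θ) (fderiv ℝ (Function.uncurry f) (z, θ) (1, 0)) z :=
  HasFDerivAt.comp_hasDerivAt z (f := fun s : ℝ => (s, θ))
    ((hf.differentiable (by simp)) (z, θ)).hasFDerivAt
    ((hasDerivAt_id z).prodMk (hasDerivAt_const z θ))

lemma continuous_deriv_fst {f : ℝ → ℝ → ℝ} (hf : ContDiff ℝ (⊤ : ℕ∞) (Function.uncurry f)) :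
    Continuous (Function.uncurry fun z θ => deriv (fun s => f s θ) z) := by
  have e : (Function.uncurry fun z θ => deriv (fun s => f s θ) z) =
      fun x => fderiv ℝ (Function.uncurry f) x (1, 0) := by
    funext ⟨z, θ⟩
    exact (hasDerivAt_fst hf z θ).deriv
  rw [e]
  exact (hf.continuous_fderiv (by simp)).clm_apply continuous_const

lemma hasDerivAt_integral_angle_sq {f : ℝ → ℝ → ℝ}
    (hf : ContDiff ℝ (⊤ : ℕ∞) (Function.uncurry f)) (z : ℝ) :
    HasDerivAt (fun x => ∫ θ in Icc 0 (π / 2), f x θ * f x θ)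
      (2 * ∫ θ in Icc 0 (π / 2), f z θ * deriv (fun s => f s θ) z) z := by
  have hfc : Continuous (Function.uncurry f) := hf.continuous
  have hdc := continuous_deriv_fst hf
  have hd : ∀ x θ, HasDerivAt (fun s => f s θ) (deriv (fun s => f s θ) x) x := fun x θ =>
    (hasDerivAt_fst hf x θ).differentiableAt.hasDerivAt
  have hFc : Continuous (Function.uncurry fun x θ => f x θ * f x θ) := hfc.mul hfc
  have hF'c : Continuous (Function.uncurry fun x θ => 2 * (f x θ * deriv (fun s => f s θ) x)) :=
    continuous_const.mul (hfc.mul hdc)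
  obtain ⟨C, hC⟩ := ((isCompact_closedBall z 1).prod
    (isCompact_Icc (a := (0 : ℝ)) (b := π / 2))).exists_bound_of_continuousOn hF'c.continuousOn
  have h := (hasDerivAt_integral_of_dominated_loc_of_deriv_le
    (μ := volume.restrict (Icc 0 (π / 2))) (s := Metric.closedBall z 1)
    (F := fun x θ => f x θ * f x θ)
    (F' := fun x θ => 2 * (f x θ * deriv (fun s => f s θ) x)) (bound := fun _ => C)
    (Metric.closedBall_mem_nhds z one_pos)
    (Eventually.of_forall fun x => (hFc.uncurry_left x).aestronglyMeasurable)
    (integrableOn_angle (hFc.uncurry_left z)) (hF'c.uncurry_left z).aestronglyMeasurable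
    ?_ (integrableOn_angle continuous_const) ?_).2
  · simpa only [integral_const_mul] using h
  · exact (ae_restrict_iff' measurableSet_Icc).2
      (Eventually.of_forall fun θ hθ x hx => hC (x, θ) ⟨hx, hθ⟩)
  · refine Eventually.of_forall fun θ x _ => ?_
    exact ((hd x θ).mul (hd x θ)).congr_deriv (by ring)

section RadialPotential

variable {f : ℝ → ℝ → ℝ} {a b : ℝ}

lemma continuous_radial_density (hf : Continuous (Function.uncurry f)) (ha : 0 < a)
    (hfa : ∀ z θ, z ≤ a → f z θ = 0) :
    Continuous fun r => ∫ θ in Icc 0 (π / 2), f r θ * Kker θ / r := by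
  have hK : Continuous (Function.uncurry fun r θ => f r θ * Kker θ) :=
    hf.mul (continuous_Kker.comp continuous_snd)
  have hc : Continuous fun r => ∫ θ in Icc 0 (π / 2), f r θ * Kker θ :=
    continuous_parametric_integral_of_continuous hK isCompact_Icc
  simp only [integral_div]
  rw [continuous_iff_continuousAt]
  intro r
  by_cases hr : r < a
  · refine continuousAt_const (y := (0 : ℝ)) |>.congr ?_
    filter_upwards [Iio_mem_nhds hr] with x hx
    simp [hfa x _ (le_of_lt hx)]
  · exact hc.continuousAt.div continuousAt_id (ne_of_gt (ha.trans_le (not_lt.1 hr)))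

lemma integrable_radial_density (hf : Continuous (Function.uncurry f)) (ha : 0 < a)
    (hfa : ∀ z θ, z ≤ a → f z θ = 0) (hfb : ∀ z θ, b ≤ z → f z θ = 0) :
    Integrable fun r => ∫ θ in Icc 0 (π / 2), f r θ * Kker θ / r := by
  refine (continuous_radial_density hf ha hfa).integrable_of_hasCompactSupport
    (HasCompactSupport.intro (isCompact_Icc (a := a) (b := b)) fun r hr => ?_)
  rcases le_or_gt r a with h | h
  · simp [hfa r _ h]
  · have hb : b ≤ r := by
      by_contra! hb
      exact hr ⟨h.le, hb.le⟩
    simp [hfb r _ hb]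

lemma L12_eq_neg_integral (hf : Continuous (Function.uncurry f)) (ha : 0 < a)
    (hfa : ∀ z θ, z ≤ a → f z θ = 0) (hfb : ∀ z θ, b ≤ z → f z θ = 0) (h0 : L12 f 0 = 0)
    (z : ℝ) : L12 f z = -∫ r in 0..z, ∫ θ in Icc 0 (π / 2), f r θ * Kker θ / r := by
  have hi := integrable_radial_density hf ha hfa hfb
  have h := intervalIntegral.integral_interval_add_Ioi (hi.integrableOn (s := Ioi 0))
    (hi.integrableOn (s := Ioi z))
  unfold L12 at h0 ⊢
  linarith

lemma hasDerivAt_L12 (hf : Continuous (Function.uncurry f)) (ha : 0 < a)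
    (hfa : ∀ z θ, z ≤ a → f z θ = 0) (hfb : ∀ z θ, b ≤ z → f z θ = 0) (h0 : L12 f 0 = 0)
    (z : ℝ) : HasDerivAt (L12 f) (-((∫ θ in Icc 0 (π / 2), f z θ * Kker θ) / z)) z := by
  rw [funext (L12_eq_neg_integral hf ha hfa hfb h0), ← integral_div]
  exact ((continuous_radial_density hf ha hfa).integral_hasStrictDerivAt 0 z).hasDerivAt.neg

lemma L12_eq_zero_of_le (hf : Continuous (Function.uncurry f)) (ha : 0 < a)
    (hfa : ∀ z θ, z ≤ a → f z θ = 0) (hfb : ∀ z θ, b ≤ z → f z θ = 0) (h0 : L12 f 0 = 0) :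
    L12 f a = 0 := by
  rw [L12_eq_neg_integral hf ha hfa hfb h0, intervalIntegral.integral_congr (g := fun _ => 0)]
  · simp
  · intro r hr
    rw [uIcc_of_le ha.le] at hr
    simp [hfa r _ hr.2]

lemma L12_eq_zero_of_ge (hfb : ∀ z θ, b ≤ z → f z θ = 0) : L12 f b = 0 :=
  setIntegral_eq_zero_of_forall_eq_zero fun r hr => by simp [hfb r _ (le_of_lt hr)]

end RadialPotential

lemma coercive_density_le {z n m A B L c k G w : ℝ} (hz : 0 < z) (hc : 0 < c) (hk : 0 < k)
    (hGk : G * k ≤ 3 / 2 * c ^ 2) (hw : w = wgt z)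
    (gram : 0 ≤ (w / 2) ^ 2 * n + (-(2 * (L / z) / c)) ^ 2 * G + (2 * (L / z) / k) ^ 2 * k
      + 2 * (w / 2) * (-(2 * (L / z) / c)) * B + 2 * (w / 2) * (2 * (L / z) / k) * A
      + 2 * (-(2 * (L / z) / c)) * (2 * (L / z) / k) * c) :
    (1 * (w * w) + z * ((-2 * (1 + z) / z ^ 3) * w + w * (-2 * (1 + z) / z ^ 3))) * n / 2
        + z * (w * w) * (2 * m) / 2
        + ((-2 * (1 + z) / z ^ 3) * (L * L) + w * (-(A / z) * L + L * -(A / z))) / k ≤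
      w ^ 2 * (n + z * m - 2 / (1 + z) * n) - 2 * w * L / (c * z) * B - 1 / 4 * (w ^ 2 * n) := by
  have hG : G / c ^ 2 ≤ 3 / (2 * k) := by
    rw [div_le_div_iff₀ (by positivity) (by positivity)]
    linarith
  have hy := mul_le_mul_of_nonneg_left hG (show 0 ≤ 4 * (L / z) ^ 2 by positivity)
  have e1 : (w / 2) ^ 2 * n + (-(2 * (L / z) / c)) ^ 2 * G + (2 * (L / z) / k) ^ 2 * k
      + 2 * (w / 2) * (-(2 * (L / z) / c)) * B + 2 * (w / 2) * (2 * (L / z) / k) * A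
      + 2 * (-(2 * (L / z) / c)) * (2 * (L / z) / k) * c =
      w ^ 2 * n / 4 + 4 * (L / z) ^ 2 * (G / c ^ 2) - 4 * (L / z) ^ 2 / k
        - 2 * w * L / (c * z) * B + 2 * w * L * A / (k * z) := by
    field_simp
    ring
  have e2 : w ^ 2 * (n + z * m - 2 / (1 + z) * n) - 2 * w * L / (c * z) * B - 1 / 4 * (w ^ 2 * n)
      - ((1 * (w * w) + z * ((-2 * (1 + z) / z ^ 3) * w + w * (-2 * (1 + z) / z ^ 3))) * n / 2
        + z * (w * w) * (2 * m) / 2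
        + ((-2 * (1 + z) / z ^ 3) * (L * L) + w * (-(A / z) * L + L * -(A / z))) / k) =
      w ^ 2 * n / 4 - 2 * w * L / (c * z) * B + 2 * w * L * A / (k * z)
        + 2 * (L / z) ^ 2 / k + 2 * (L / z) ^ 2 / (k * z) := by
    rw [hw, wgt]
    field_simp
    ring
  have e3 : 4 * (L / z) ^ 2 * (3 / (2 * k)) = 6 * (L / z) ^ 2 / k := by
    field_simp
    ring
  have e4 : 6 * (L / z) ^ 2 / k - 4 * (L / z) ^ 2 / k = 2 * (L / z) ^ 2 / k := by ring
  have h5 : 0 ≤ 2 * (L / z) ^ 2 / (k * z) := by positivity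
  linarith

lemma ip_eq_intervalIntegral {A B : ℝ → ℝ → ℝ} {E : ℝ → ℝ} {a b : ℝ} (ha : 0 < a) (hab : a ≤ b)
    (hE : ∀ z, a < z → ∫ θ in Icc 0 (π / 2), A z θ * B z θ = E z)
    (hBa : ∀ z θ, z ≤ a → B z θ = 0) (hBb : ∀ z θ, b ≤ z → B z θ = 0) :
    ip A B = ∫ z in a..b, E z := by
  rw [intervalIntegral.integral_of_le hab, ip,
    setIntegral_eq_of_subset_of_forall_sdiff_eq_zero measurableSet_Ioi
      (fun z (hz : z ∈ Ioc a b) => ha.trans hz.1)]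
  · exact setIntegral_congr_fun measurableSet_Ioc fun z hz => hE z hz.1
  · intro z hz
    rcases le_or_gt z a with h | h
    · simp [hBa z _ h]
    · have hb : b ≤ z := by
        by_contra! hb
        exact hz.2 ⟨h, hb.le⟩
      simp [hBb z _ hb]

lemma hasDerivAt_wgt {z : ℝ} (hz : 0 < z) : HasDerivAt wgt (-2 * (1 + z) / z ^ 3) z := by
  have h := (((hasDerivAt_id z).const_add 1).pow 2).div ((hasDerivAt_id z).pow 2)
    (by simpa using hz.ne')
  refine h.congr_deriv ?_
  simp only [id, Pi.pow_apply]
  field_simp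
  ring

lemma integral_LGam_mul {α : ℝ} (hα : α ∈ Ioc (0 : ℝ) 1) {f : ℝ → ℝ → ℝ}
    (hf : ContDiff ℝ (⊤ : ℕ∞) (Function.uncurry f)) {z : ℝ} (hz : 0 < z) :
    ∫ θ in Icc 0 (π / 2), LGam α f z θ * wgt z * (f z θ * wgt z) =
      wgt z ^ 2 * ((∫ θ in Icc 0 (π / 2), f z θ * f z θ)
          + z * (∫ θ in Icc 0 (π / 2), f z θ * deriv (fun s => f s θ) z)
          - 2 / (1 + z) * ∫ θ in Icc 0 (π / 2), f z θ * f z θ)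
        - 2 * wgt z * L12 f z / (cGam α * z) * ∫ θ in Icc 0 (π / 2), f z θ * Gam α θ := by
  have hc := (cGam_pos hα).ne'
  have h0 : Continuous (f z) := hf.continuous.uncurry_left z
  have h1 : Continuous fun θ => deriv (fun s => f s θ) z := (continuous_deriv_fst hf).uncurry_left z
  have h2 := continuous_Gam hα.1.le
  have e : (fun θ => LGam α f z θ * wgt z * (f z θ * wgt z)) = fun θ =>
      wgt z ^ 2 * (1 - 2 / (1 + z)) * (f z θ * f z θ)
        + wgt z ^ 2 * z * (f z θ * deriv (fun s => f s θ) z)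
        - 2 * wgt z * L12 f z / (cGam α * z) * (f z θ * Gam α θ) := by
    funext θ
    simp only [LGam, Lop, wgt]
    field_simp
    ring
  rw [e, integral_sub, integral_add]
  · simp only [integral_const_mul]
    ring
  all_goals exact integrableOn_angle (by fun_prop)

lemma Admissible.exists_support {f : ℝ → ℝ → ℝ} (hf : Admissible f) :
    ∃ a b : ℝ, 0 < a ∧ a ≤ b ∧ (∀ z θ, z ≤ a → f z θ = 0) ∧ ∀ z θ, b ≤ z → f z θ = 0 := by
  obtain ⟨-, a, b, ha, h⟩ := hf
  refine ⟨a / 2, max a b + 1, by positivity, ?_, fun z θ hz => h z θ fun hh => ?_,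
    fun z θ hz => h z θ fun hh => ?_⟩
  · linarith [le_max_left a b]
  · linarith [hh.1]
  · linarith [hh.2, le_max_right a b]

/-- Weighted `L²` coercivity of `𝓛_Γ`: for every `α ∈ (0,1]` and admissible `f` with
`L₁₂(f)(0) = 0`, `(𝓛_Γ(f)·w, f·w)_{L²} ≥ (1/4)‖f·w‖²_{L²}`. -/
theorem LGam_coercive (α : ℝ) (hα : α ∈ Ioc (0 : ℝ) 1)
    (f : ℝ → ℝ → ℝ) (hf : Admissible f) (hf0 : L12 f 0 = 0) :
    ip (fun z θ => LGam α f z θ * wgt z) (fun z θ => f z θ * wgt z) ≥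
      (1 / 4) * ip (fun z θ => f z θ * wgt z) (fun z θ => f z θ * wgt z) := by
  obtain ⟨a, b, ha, hab, hfa, hfb⟩ := hf.exists_support
  have hs := hf.1
  have hfc : Continuous (Function.uncurry f) := hs.continuous
  set n : ℝ → ℝ := fun z => ∫ θ in Icc 0 (π / 2), f z θ * f z θ with hn
  set m : ℝ → ℝ := fun z => ∫ θ in Icc 0 (π / 2), f z θ * deriv (fun s => f s θ) z
  set A : ℝ → ℝ := fun z => ∫ θ in Icc 0 (π / 2), f z θ * Kker θ
  set B : ℝ → ℝ := fun z => ∫ θ in Icc 0 (π / 2), f z θ * Gam α θ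
  set k : ℝ := ∫ θ in Icc 0 (π / 2), Kker θ * Kker θ with hk
  have hkpos : 0 < k := by
    rw [hk, integral_Kker_sq]
    positivity
  have hcpos := cGam_pos hα
  have hn' : ∀ z, HasDerivAt n (2 * m z) z := hasDerivAt_integral_angle_sq hs
  have hL' : ∀ z, HasDerivAt (L12 f) (-(A z / z)) z := hasDerivAt_L12 hfc ha hfa hfb hf0
  have hnc : Continuous n := continuous_iff_continuousAt.2 fun z => (hn' z).continuousAt
  have hLc : Continuous (L12 f) := continuous_iff_continuousAt.2 fun z => (hL' z).continuousAt
  have hmc : Continuous m := continuous_parametric_integral_of_continuous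
    (f := fun z θ => f z θ * deriv (fun s => f s θ) z)
    (hfc.mul (continuous_deriv_fst hs)) isCompact_Icc
  have hBc : Continuous B := continuous_parametric_integral_of_continuous
    (f := fun z θ => f z θ * Gam α θ)
    (hfc.mul ((continuous_Gam hα.1.le).comp continuous_snd)) isCompact_Icc
  have hpos : ∀ z ∈ Icc a b, 0 < z := fun z hz => ha.trans_le hz.1
  have hwc : ContinuousOn wgt (Icc a b) := fun z hz =>
    (hasDerivAt_wgt (hpos z hz)).continuousAt.continuousWithinAt
  set E : ℝ → ℝ := fun z => wgt z ^ 2 * (n z + z * m z - 2 / (1 + z) * n z)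
    - 2 * wgt z * L12 f z / (cGam α * z) * B z
  set N : ℝ → ℝ := fun z => wgt z ^ 2 * n z with hN
  have hNc : ContinuousOn N (Icc a b) := (hwc.pow 2).mul hnc.continuousOn
  have hEc : ContinuousOn E (Icc a b) := by
    refine ((hwc.pow 2).mul (ContinuousOn.sub (by fun_prop) (ContinuousOn.mul
      (continuousOn_const.div (by fun_prop) fun z hz => ?_) hnc.continuousOn))).sub
      (ContinuousOn.mul (((continuousOn_const.mul hwc).mul hLc.continuousOn).div (by fun_prop)
        fun z hz => ?_) hBc.continuousOn)
    · linarith [hpos z hz]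
    · exact (mul_pos hcpos (hpos z hz)).ne'
  have ip1 : ip (fun z θ => LGam α f z θ * wgt z) (fun z θ => f z θ * wgt z) =
      ∫ z in a..b, E z :=
    ip_eq_intervalIntegral ha hab (fun z hz => integral_LGam_mul hα hs (ha.trans hz))
      (fun z θ hz => by simp [hfa z θ hz]) (fun z θ hz => by simp [hfb z θ hz])
  have ip2 : ip (fun z θ => f z θ * wgt z) (fun z θ => f z θ * wgt z) = ∫ z in a..b, N z := by
    refine ip_eq_intervalIntegral ha hab (fun z _ => ?_)
      (fun z θ hz => by simp [hfa z θ hz]) (fun z θ hz => by simp [hfb z θ hz])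
    simp only [hN, hn]
    rw [← integral_const_mul]
    congr 1
    funext θ
    ring
  set H : ℝ → ℝ := fun z => z * (wgt z * wgt z) * n z / 2 + wgt z * (L12 f z * L12 f z) / k with hH
  have hH' : ∀ z ∈ Icc a b, HasDerivAt H
      ((1 * (wgt z * wgt z) + z * ((-2 * (1 + z) / z ^ 3) * wgt z
          + wgt z * (-2 * (1 + z) / z ^ 3))) * n z / 2
        + z * (wgt z * wgt z) * (2 * m z) / 2
        + ((-2 * (1 + z) / z ^ 3) * (L12 f z * L12 f z)
          + wgt z * (-(A z / z) * L12 f z + L12 f z * -(A z / z))) / k) z := by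
    intro z hz
    have hw' := hasDerivAt_wgt (hpos z hz)
    refine (((((hasDerivAt_id z).mul (hw'.mul hw')).mul (hn' z)).div_const 2).add
      ((hw'.mul ((hL' z).mul (hL' z))).div_const k)).congr_deriv ?_
    simp only [id, Pi.mul_apply]
    ring
  have hna : n a = 0 := by simp [hn, hfa a _ le_rfl]
  have hnb : n b = 0 := by simp [hn, hfb b _ le_rfl]
  have hHa : H a = 0 := by
    simp [hH, hna, L12_eq_zero_of_le hfc ha hfa hfb hf0]
  have hHb : H b = 0 := by
    simp [hH, hnb, L12_eq_zero_of_ge hfb]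
  have key := intervalIntegral.sub_le_integral_of_hasDeriv_right_of_le (g := H)
    (φ := fun z => E z - 1 / 4 * N z) hab
    (fun z hz => (hH' z hz).continuousAt.continuousWithinAt)
    (fun z hz => (hH' z (Ioo_subset_Icc_self hz)).hasDerivWithinAt)
    ((hEc.sub (continuousOn_const.mul hNc)).integrableOn_Icc)
    (fun z hz => coercive_density_le (hpos z (Ioo_subset_Icc_self hz)) hcpos hkpos
      (integral_Gam_sq_mul_integral_Kker_sq_le hα) rfl
      (gram_form_nonneg (hfc.uncurry_left z) (continuous_Gam hα.1.le) continuous_Kker _ _ _))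
  have hNi : IntervalIntegrable (fun z => 1 / 4 * N z) volume a b :=
    (continuousOn_const.mul hNc).intervalIntegrable_of_Icc hab
  rw [intervalIntegral.integral_sub (hEc.intervalIntegrable_of_Icc hab) hNi,
    intervalIntegral.integral_const_mul, hHa, hHb] at key
  rw [ip1, ip2]
  linarith
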